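/- If H is a numerical monoid with exactly 5 atoms, then the singleton {3} is an element of 𝓛(H); that is, there exists a ∈ H whose set of lengths L(a) equals {3}. -/

import Mathlib

/-- A numerical monoid: an additive submonoid of `ℕ` whose complement in `ℕ` is finite. -/
def IsNumericalMonoid (H : AddSubmonoid ℕ) : Prop :=
  ((H : Set ℕ)ᶜ).Finite

/-- `u` is an atom of `H`: it is a nonzero element of `H` which cannot be written as the
sum of two nonzero elements of `H`. -/
def IsAtomOf (H : AddSubmonoid ℕ) (u : ℕ) : Prop :=
  u ∈ H ∧ u ≠ 0 ∧ ∀ x y : ℕ, x ∈ H → y ∈ H → x ≠ 0 → y ≠ 0 → u ≠ x + y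

/-- The set of atoms of `H`. -/
def atomSet (H : AddSubmonoid ℕ) : Set ℕ := {u | IsAtomOf H u}

/-- The set of lengths of `a`: all `k` such that `a` is a sum of `k` atoms of `H`.
(For `a = 0` this gives `{0}`, via the empty sum, matching the convention `L(0) = {0}`.) -/
def lengthSet (H : AddSubmonoid ℕ) (a : ℕ) : Set ℕ :=
  {k | ∃ s : Multiset ℕ, Multiset.card s = k ∧ (∀ u ∈ s, IsAtomOf H u) ∧ s.sum = a}

/-- The system of sets of lengths of `H`. -/
def systemOfLengths (H : AddSubmonoid ℕ) : Set (Set ℕ) :=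
  {L | ∃ a ∈ H, L = lengthSet H a}

/-- `s` is a sum of two of the numbers `a`, `b`, `c`, `d`. -/
def IsSumOfTwo (a b c d s : ℕ) : Prop :=
  a + a = s ∨ a + b = s ∨ a + c = s ∨ a + d = s ∨ b + b = s ∨
  b + c = s ∨ b + d = s ∨ c + c = s ∨ c + d = s ∨ d + d = s

/-- `s` is a sum of four of the numbers `a`, `b`, `c`, `d`. -/
def IsSumOfFour (a b c d s : ℕ) : Prop :=
  a + a + a + a = s ∨ a + a + a + b = s ∨ a + a + a + c = s ∨ a + a + a + d = s ∨
  a + a + b + b = s ∨ a + a + b + c = s ∨ a + a + b + d = s ∨ a + a + c + c = s ∨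
  a + a + c + d = s ∨ a + a + d + d = s ∨ a + b + b + b = s ∨ a + b + b + c = s ∨
  a + b + b + d = s ∨ a + b + c + c = s ∨ a + b + c + d = s ∨ a + b + d + d = s ∨
  a + c + c + c = s ∨ a + c + c + d = s ∨ a + c + d + d = s ∨ a + d + d + d = s ∨
  b + b + b + b = s ∨ b + b + b + c = s ∨ b + b + b + d = s ∨ b + b + c + c = s ∨
  b + b + c + d = s ∨ b + b + d + d = s ∨ b + c + c + c = s ∨ b + c + c + d = s ∨
  b + c + d + d = s ∨ b + d + d + d = s ∨ c + c + c + c = s ∨ c + c + c + d = s ∨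
  c + c + d + d = s ∨ c + d + d + d = s ∨ d + d + d + d = s

set_option maxHeartbeats 4000000 in
/-- There are no `a < b < c < d < e`, none of them a sum of two others, such that, for
`x` among them, each `2 * a + x` below `4 * a` is a sum of two and each one below `5 * a` is a sum of two or four
of these numbers. -/
theorem not_two_mul_add_atom_shorter_or_longer {a b c d e : ℕ} (ha : 0 < a)
    (hab : a < b) (hbc : b < c) (hcd : c < d) (hde : d < e)
    (hS : ∀ z ∈ [a, b, c, d, e], ∀ u ∈ [a, b, c, d, e], ∀ v ∈ [a, b, c, d, e], z ≠ u + v)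
    (G : ∀ x ∈ [a, b, c, d, e], 2 * a + x < 4 * a →
      IsSumOfTwo b c d e (2 * a + x))
    (Q : ∀ x ∈ [a, b, c, d, e], 2 * a < x → x < 3 * a →
      IsSumOfTwo b c d e (2 * a + x) ∨
      IsSumOfFour a b c d (2 * a + x)) : False := by
  have b0 : b ≠ a + a := hS b (by simp) a (by simp) a (by simp)
  have c0 : c ≠ a + a := hS c (by simp) a (by simp) a (by simp)
  have d0 : d ≠ a + a := hS d (by simp) a (by simp) a (by simp)
  have e0 : e ≠ a + a := hS e (by simp) a (by simp) a (by simp)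
  have dab : d ≠ a + b := hS d (by simp) a (by simp) b (by simp)
  have eab : e ≠ a + b := hS e (by simp) a (by simp) b (by simp)
  have eac : e ≠ a + c := hS e (by simp) a (by simp) c (by simp)
  have ead : e ≠ a + d := hS e (by simp) a (by simp) d (by simp)
  have ebb : e ≠ b + b := hS e (by simp) b (by simp) b (by simp)
  clear hS
  simp only [IsSumOfTwo, IsSumOfFour] at G Q
  have h0 := G a (by simp) (by omega)
  have hb : 2 * b ≤ 3 * a := by omega
  have h1 := G b (by simp) (by omega)
  have hc : 2 * c ≤ 2 * a + b := by omega
  have h2 := G c (by simp) (by omega)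
  have he : 2 * a < e := by
    by_contra h
    have h4 := G e (by simp) (by omega)
    clear h0 h1 h2 G Q
    omega
  have Qe := Q e (by simp) he
  have Qd := Q d (by simp)
  have h3 := G d (by simp)
  clear G Q
  rcases lt_or_gt_of_ne d0 with hd | hd
  · replace h3 : b + e = 2 * a + d ∨ c + e = 2 * a + d := by
      replace h3 := h3 (by omega)
      clear h0 h1 h2 Qe Qd
      omega
    clear Qd
    replace h0 : b + b = 3 * a ∨ b + c = 3 * a ∨ b + d = 3 * a ∨
      c + c = 3 * a ∨ c + d = 3 * a ∨ d + d = 3 * a := by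
      clear h1 h2 h3 Qe; omega
    replace h1 : c + c = 2 * a + b ∨ c + d = 2 * a + b ∨ d + d = 2 * a + b := by
      clear h0 h2 h3 Qe; omega
    replace h2 : b + d = 2 * a + c ∨ b + e = 2 * a + c ∨ d + d = 2 * a + c := by
      clear h0 h1 h3 Qe; omega
    replace Qe := Qe (by clear h0 h1 h2; omega)
    rcases h3 with h3 | h3 <;> rcases h2 with h2 | h2 | h2 <;>
    (try (exfalso; clear h0 h1 Qe; omega)) <;>
    rcases h1 with h1 | h1 | h1 <;> (try (exfalso; clear h0 Qe; omega)) <;>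
    rcases h0 with h0 | h0 | h0 | h0 | h0 | h0 <;> (try (exfalso; clear Qe; omega))
    all_goals
      clear he hb hc
      casesm* _ ∨ _ <;> omega
  · have e3 : b + d = 2 * a + c ∨ b + e = 2 * a + c := by
      clear h0 h1 h3 Qe Qd; omega
    have hd3 : d < 3 * a := by clear h0 h1 h2 h3 Qe Qd; omega
    replace Qd := Qd (by omega) hd3
    clear h3 h2
    replace h1 : c + c = 2 * a + b := by clear h0 Qe Qd; omega
    replace h0 : b + b = 3 * a ∨ b + c = 3 * a := by clear Qe Qd; omega
    rcases h0 with h0 | h0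
    · rcases e3 with h3 | h3
      · clear Qe
        casesm* _ ∨ _ <;> omega
      · replace Qe := Qe (by omega)
        have hd2 : d + d = 2 * a + e := by
          clear Qd
          casesm* _ ∨ _ <;> omega
        clear Qe
        casesm* _ ∨ _ <;> omega
    · omega

theorem eq_sum_of_card_eq_four {a b c d : ℕ} (hab : a < b) (hbc : b < c) (hcd : c < d)
    {s : Multiset ℕ} (hs : ∀ u ∈ s, u = a ∨ u = b ∨ u = c ∨ u = d) (h4 : Multiset.card s = 4) :
    IsSumOfFour a b c d s.sum := by
  have hs' : ∀ u ∈ s, u ∈ ({a, b, c, d} : Finset ℕ) := by simpa using hs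
  have hn := Multiset.sum_count_eq_card hs'
  have hv := Finset.sum_multiset_count_of_subset s {a, b, c, d} (by
    intro u hu; exact hs' u (Multiset.mem_toFinset.1 hu))
  have ha : a ∉ ({b, c, d} : Finset ℕ) := by simp; omega
  have hb : b ∉ ({c, d} : Finset ℕ) := by simp; omega
  have hc : c ∉ ({d} : Finset ℕ) := by simp; omega
  rw [Finset.sum_insert ha, Finset.sum_insert hb, Finset.sum_insert hc,
    Finset.sum_singleton] at hn hv
  rw [h4] at hn
  rw [hv]
  simp only [IsSumOfFour, smul_eq_mul]
  generalize s.count a = p at *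
  generalize s.count b = q at *
  generalize s.count c = r at *
  generalize s.count d = t at *
  clear hv hs hs' h4 ha hb hc hab hbc hcd
  have hp : p ≤ 4 := by omega
  have hq : q ≤ 4 := by omega
  have hr : r ≤ 4 := by omega
  obtain rfl : t = 4 - p - q - r := by omega
  interval_cases p <;> interval_cases q <;> interval_cases r <;> try (exfalso; omega)
  all_goals
    clear hn hp hq hr
    repeat first | (left; omega) | right | omega

theorem exists_length_ne_three {H : AddSubmonoid ℕ} (h : ∀ y ∈ H, lengthSet H y ≠ {3})
    {a x : ℕ} (ha : IsAtomOf H a) (hx : IsAtomOf H x) :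
    ∃ s : Multiset ℕ, Multiset.card s ≠ 3 ∧ (∀ u ∈ s, IsAtomOf H u) ∧ s.sum = 2 * a + x := by
  by_contra! hne
  refine h (2 * a + x) (by simpa [two_mul] using H.add_mem (H.add_mem ha.1 ha.1) hx.1) ?_
  ext k
  simp only [lengthSet, Set.mem_ofPred_eq, Set.mem_singleton_iff]
  constructor
  · rintro ⟨s, rfl, hs, hsum⟩
    by_contra hk
    exact hne s hk hs hsum
  · rintro rfl
    refine ⟨{a, a, x}, by simp, ?_, by simp; ring⟩
    simp [ha, hx]

theorem card_eq_two_or_four_of_sum_eq {H : AddSubmonoid ℕ} {a x : ℕ} (ha : IsAtomOf H a)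
    (hmin : ∀ u, IsAtomOf H u → a ≤ u) (hx : IsAtomOf H x) (hlt : x < 3 * a)
    {s : Multiset ℕ} (h3 : Multiset.card s ≠ 3) (hs : ∀ u ∈ s, IsAtomOf H u)
    (hsum : s.sum = 2 * a + x) : Multiset.card s = 2 ∨ Multiset.card s = 4 := by
  have hle : Multiset.card s * a ≤ s.sum := by
    simpa using Multiset.card_nsmul_le_sum (fun u hu => hmin u (hs u hu))
  have h5 : Multiset.card s < 5 := by
    by_contra! h5
    nlinarith [Nat.mul_le_mul_right a h5]
  have h0 : Multiset.card s ≠ 0 := by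
    intro h0
    rw [Multiset.card_eq_zero] at h0
    subst h0
    have := hx.2.1
    simp at hsum
    omega
  have h1 : Multiset.card s ≠ 1 := by
    intro h1
    obtain ⟨u, rfl⟩ := Multiset.card_eq_one.1 h1
    refine (hs u (by simp)).2.2 a (a + x) ha.1 (H.add_mem ha.1 hx.1) ha.2.1
      (by have := ha.2.1; omega) ?_
    simp at hsum
    omega
  omega

theorem exists_five_atoms {H : AddSubmonoid ℕ} (hcard : (atomSet H).ncard = 5) :
    ∃ a b c d e : ℕ, a < b ∧ b < c ∧ c < d ∧ d < e ∧
      ∀ u, IsAtomOf H u ↔ u ∈ [a, b, c, d, e] := by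
  have hfin : (atomSet H).Finite := Set.finite_of_ncard_ne_zero (by omega)
  have hc : hfin.toFinset.card = 5 := by rw [← Set.ncard_eq_toFinset_card _ hfin, hcard]
  let f := hfin.toFinset.orderEmbOfFin hc
  refine ⟨f 0, f 1, f 2, f 3, f 4, f.strictMono (by decide), f.strictMono (by decide),
    f.strictMono (by decide), f.strictMono (by decide), fun u => ?_⟩
  have hu : u ∈ Set.range f ↔ IsAtomOf H u := by
    rw [Finset.range_orderEmbOfFin]
    simp [atomSet]
  rw [← hu]
  simp [Fin.exists_fin_succ, eq_comm]

theorem stmt_7 (H : AddSubmonoid ℕ) (hH : IsNumericalMonoid H)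
    (hcard : (atomSet H).ncard = 5) :
    ({3} : Set ℕ) ∈ systemOfLengths H ∧ ∃ a ∈ H, lengthSet H a = {3} := by
  suffices h : ∃ y ∈ H, lengthSet H y = {3} from
    ⟨let ⟨y, hy, hL⟩ := h; ⟨y, hy, hL.symm⟩, h⟩
  by_contra! hne
  obtain ⟨a, b, c, d, e, hab, hbc, hcd, hde, hA⟩ := exists_five_atoms hcard
  have ha : IsAtomOf H a := (hA a).2 (by simp)
  have ha0 : 0 < a := Nat.pos_of_ne_zero ha.2.1
  have hmin : ∀ u, IsAtomOf H u → a ≤ u := by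
    intro u hu
    have := (hA u).1 hu
    simp only [List.mem_cons, List.not_mem_nil, or_false] at this
    omega
  have hS : ∀ z, IsAtomOf H z → ∀ u, IsAtomOf H u → ∀ v, IsAtomOf H v → z ≠ u + v :=
    fun z hz u hu v hv => hz.2.2 u v hu.1 hv.1 hu.2.1 hv.2.1
  have key : ∀ x, IsAtomOf H x → x < 3 * a →
      IsSumOfTwo b c d e (2 * a + x) ∨
      2 * a ≤ x ∧
      IsSumOfFour a b c d (2 * a + x) := by
    intro x hx hlt
    obtain ⟨s, h3, hs, hsum⟩ := exists_length_ne_three hne ha hx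
    rcases card_eq_two_or_four_of_sum_eq ha hmin hx hlt h3 hs hsum with h2 | h4
    · left
      obtain ⟨u, v, rfl⟩ := Multiset.card_eq_two.1 h2
      have hu : IsAtomOf H u := hs u (by simp)
      have hv : IsAtomOf H v := hs v (by simp)
      have huv : u + v = 2 * a + x := by simpa using hsum
      have hua : u ≠ a := fun h => hS v hv a ha x hx (by omega)
      have hva : v ≠ a := fun h => hS u hu a ha x hx (by omega)
      rw [hA] at hu hv
      simp only [List.mem_cons, List.not_mem_nil, or_false, hua, hva, false_or] at hu hv
      rw [← huv]
      rcases hu with rfl | rfl | rfl | rfl <;> rcases hv with rfl | rfl | rfl | rfl <;>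
        simp [IsSumOfTwo, add_comm]
    · right
      have hle : Multiset.card s * a ≤ s.sum := by
        simpa using Multiset.card_nsmul_le_sum (fun u hu => hmin u (hs u hu))
      rw [h4] at hle
      refine ⟨by omega, ?_⟩
      rw [← hsum]
      refine eq_sum_of_card_eq_four hab hbc hcd (fun u hu => ?_) h4
      have hue : u ≠ e := by
        rintro rfl
        obtain ⟨t, rfl⟩ := Multiset.exists_cons_of_mem hu
        have hlt : Multiset.card t * a ≤ t.sum := by
          simpa using Multiset.card_nsmul_le_sum
            (fun v hv => hmin v (hs v (Multiset.mem_cons_of_mem hv)))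
        have ht : Multiset.card t = 3 := by simpa using h4
        rw [ht] at hlt
        rw [Multiset.sum_cons] at hsum
        have hxe := (hA x).1 hx
        simp only [List.mem_cons, List.not_mem_nil, or_false] at hxe
        omega
      simpa [hue] using (hA u).1 (hs u hu)
  refine not_two_mul_add_atom_shorter_or_longer ha0 hab hbc hcd hde
    (fun z hz u hu v hv => hS z ((hA z).2 hz) u ((hA u).2 hu) v ((hA v).2 hv)) ?_ ?_
  · intro x hx hlt
    rcases key x ((hA x).2 hx) (by omega) with h | ⟨h, -⟩
    · exact h
    · omega
  · intro x hx _ hlt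
    exact (key x ((hA x).2 hx) hlt).imp_right And.right
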